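/- (Identity principle, fractional case.) Assume g and h are affine: g(u) = δ₁u + δ₂, h(v) = ρ₁v + ρ₂ with δ₁, ρ₁ > 0, and let f ∈ _{RL}SM^{(α,β)}_{(g,h)}(S_{a,b,c}) and I ∈ 𝕊. For z = u + Iv ∈ S_{a,b,c,I} write Re z = u and Im z = v (v ≥ 0). If the set {z ∈ S_{a,b,c,I} : ρ₁ A_I(Re z) + δ₁ B_I(Im z) = 0} (equivalently, the zero set of F_I, where F_I(u + Iv) := (1/δ₁) A_I(u) + (1/ρ₁) B_I(v)) has an accumulation point in the interior int(S_{a,b,c,I}), then ρ₁ A_I(Re z) + δ₁ B_I(Im z) = 0 for all z ∈ S_{a,b,c,I}, i.e. F_I ≡ 0 on S_{a,b,c,I}. -/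

import Mathlib

open scoped BigOperators
open Set

noncomputable section

/-- The sphere 𝕊 of (coefficient vectors of) unit 1-vectors in ℝⁿ. -/
def USphere (n : ℕ) : Set (Fin n → ℝ) := {x | ∑ i, x i ^ 2 = 1}

/-- Points of ℝ^{n+1}, written as (x₀, (x₁, …, xₙ)). -/
abbrev Pt (n : ℕ) := ℝ × (Fin n → ℝ)

variable {n : ℕ} {Cl : Type} [NormedRing Cl] [NormedAlgebra ℝ Cl]

/-- The 1-vector of the Clifford algebra with coefficients `x` w.r.t. generators `e`. -/
def vecEmb (e : Fin n → Cl) (x : Fin n → ℝ) : Cl := ∑ i, x i • e i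

/-- The defining relations `eᵢeⱼ + eⱼeᵢ = -2δᵢⱼ` of the Clifford algebra ℝₙ. -/
def CliffordRel (e : Fin n → Cl) : Prop :=
  ∀ i j, e i * e j + e j * e i = if i = j then (-2 : Cl) else 0

/-- The slice Cauchy–Riemann operator `(∂/∂u + I ∂/∂v)` applied to the restriction of `f`
to the slice `ℂ_I`, `I = vecEmb e x`, evaluated at the point `u + I v`. -/
def sliceCR (e : Fin n → Cl) (f : Pt n → Cl) (x : Fin n → ℝ) (u v : ℝ) : Cl :=
  deriv (fun t => f (t, v • x)) u + vecEmb e x * deriv (fun t => f (u, t • x)) v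

/-- λ-slice monogenic functions on `U`. -/
def SMlam (e : Fin n → Cl) (lam : ℝ) (U : Set (Pt n)) (f : Pt n → Cl) : Prop :=
  ContDiffOn ℝ 1 f U ∧
  ∀ x ∈ USphere n, ∀ u v : ℝ, ((u, v • x) : Pt n) ∈ U →
    sliceCR e f x u v + lam • f (u, v • x) = 0

/-- The coordinates (u,v) of the slice `U_I = U ∩ ℂ_I`, `I = vecEmb e x`. -/
def SlicePre (n : ℕ) (U : Set (Pt n)) (x : Fin n → ℝ) : Set (ℝ × ℝ) :=
  {p | ((p.1, p.2 • x) : Pt n) ∈ U}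

/-- Axially symmetric slice domains in ℝ^{n+1}. -/
def AxSymSDomain (n : ℕ) (U : Set (Pt n)) : Prop :=
  IsOpen U ∧ IsConnected U ∧ (∃ u : ℝ, ((u, (0 : Fin n → ℝ)) : Pt n) ∈ U) ∧
  (∀ x ∈ USphere n, IsConnected (SlicePre n U x)) ∧
  ∀ x ∈ USphere n, ∀ y ∈ USphere n, ∀ u v : ℝ,
    ((u, v • x) : Pt n) ∈ U → ((u, v • y) : Pt n) ∈ U

/-- A holomorphic function with values in `ℂ_I`, `I = vecEmb e x`, on a
(relatively open) coordinate set `V`. -/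
def SliceHolo (e : Fin n → Cl) (x : Fin n → ℝ) (V : Set (ℝ × ℝ)) (F : ℝ × ℝ → Cl) : Prop :=
  DifferentiableOn ℝ F V ∧
  (∀ p ∈ V, ∃ a b : ℝ, F p = algebraMap ℝ Cl a + b • vecEmb e x) ∧
  ∀ p ∈ V, deriv (fun t => F (t, p.2)) p.1 + vecEmb e x * deriv (fun t => F (p.1, t)) p.2 = 0

/-- Ordered product `I_A = I_{i₁} ⋯ I_{i_k}` over a finite index set `A`. -/
def IAprod (e : Fin n → Cl) (J : Fin n → Fin n → ℝ) (A : Finset (Fin n)) : Cl :=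
  ((A.sort (· ≤ ·)).map fun i => vecEmb e (J i)).prod

/-- A closed piecewise-C¹ curve parametrized on [0,1]. -/
def PiecewiseC1 (γ : ℝ → ℝ × ℝ) : Prop :=
  ContinuousOn γ (Icc 0 1) ∧
  ∃ (k : ℕ) (t : Fin (k + 1) → ℝ), t 0 = 0 ∧ t (Fin.last k) = 1 ∧ StrictMono t ∧
    ∀ i : Fin k, ContDiffOn ℝ 1 γ (Icc (t i.castSucc) (t i.succ))

/-- `γ` is a closed curve in `V`, homotopic within `V` to a constant curve. -/
def NullHomotopicIn (γ : ℝ → ℝ × ℝ) (V : Set (ℝ × ℝ)) : Prop :=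
  γ 0 = γ 1 ∧ (∀ t ∈ Icc (0:ℝ) 1, γ t ∈ V) ∧
  ∃ (H : ℝ × ℝ → ℝ × ℝ) (p : ℝ × ℝ),
    ContinuousOn H (Icc 0 1 ×ˢ Icc 0 1) ∧
    (∀ q ∈ (Icc (0:ℝ) 1 ×ˢ Icc (0:ℝ) 1), H q ∈ V) ∧
    (∀ t ∈ Icc (0:ℝ) 1, H (0, t) = γ t) ∧
    (∀ t ∈ Icc (0:ℝ) 1, H (1, t) = p) ∧
    (∀ s ∈ Icc (0:ℝ) 1, H (s, 0) = H (s, 1))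

/-- The inverse `(a + bI)⁻¹` computed in the field `ℂ_I`, `I = vecEmb e x`. -/
def sliceInv (e : Fin n → Cl) (x : Fin n → ℝ) (a b : ℝ) : Cl :=
  (a ^ 2 + b ^ 2)⁻¹ • (algebraMap ℝ Cl a - b • vecEmb e x)

/-- The closed Euclidean ball of ℝ^{n+1}. -/
def EucClosedBall (y : Pt n) (ρ : ℝ) : Set (Pt n) :=
  {p | (p.1 - y.1) ^ 2 + ∑ i, (p.2 i - y.2 i) ^ 2 ≤ ρ ^ 2}

/-- Left fractional integral of order `σ` with respect to `g` (with derivative `g'`),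
with base point `aa`. -/
def fracInt (aa σ : ℝ) (g g' : ℝ → ℝ) (φ : ℝ → Cl) (u : ℝ) : Cl :=
  (Real.Gamma σ)⁻¹ • ∫ τ in aa..u, ((g u - g τ) ^ (σ - 1) * g' τ) • φ τ

/-- Right fractional integral of order `σ` with respect to `h` (with derivative `h'`),
with base point `cc`. -/
def fracIntR (cc σ : ℝ) (h h' : ℝ → ℝ) (φ : ℝ → Cl) (v : ℝ) : Cl :=
  (Real.Gamma σ)⁻¹ • ∫ τ in v..cc, ((h τ - h v) ^ (σ - 1) * h' τ) • φ τ

/-- Left Riemann–Liouville fractional derivative of order `al` w.r.t. `g` on `[aa, bb]`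
(one-sided derivatives at the endpoints). -/
def rlD (aa bb al : ℝ) (g g' : ℝ → ℝ) (φ : ℝ → Cl) (u : ℝ) : Cl :=
  (g' u)⁻¹ • derivWithin (fracInt aa (1 - al) g g' φ) (Icc aa bb) u

/-- The set `S_{a,b,c} ⊆ ℝ^{n+1}`. -/
def Sabc (n : ℕ) (a b c : ℝ) : Set (Pt n) :=
  {p | ∃ x ∈ USphere n, ∃ u ∈ Icc a b, ∃ v ∈ Icc 0 c, p = ((u, v • x) : Pt n)}

/-- Absolutely continuous function on `[a,b]`. -/
def AbsContOn {E : Type} [NormedAddCommGroup E] (φ : ℝ → E) (a b : ℝ) : Prop :=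
  ∀ ε > (0:ℝ), ∃ δ > (0:ℝ), ∀ (k : ℕ) (p q : Fin k → ℝ),
    (∀ i, p i ∈ Icc a b ∧ q i ∈ Icc a b ∧ p i ≤ q i) →
    (∀ i j, i ≠ j → Ioo (p i) (q i) ∩ Ioo (p j) (q j) = ∅) →
    (∑ i, (q i - p i)) < δ → (∑ i, ‖φ (q i) - φ (p i)‖) < ε

/-- The class `AC¹(S_{a,b,c}, ℝₙ)`. -/
def AC1 (a b c r s : ℝ) (f : Pt n → Cl) : Prop :=
  ContinuousOn f (Sabc n a b c) ∧
  ∀ x ∈ USphere n,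
    AbsContOn (fun u => f (u, s • x)) a b ∧ AbsContOn (fun v => f (r, v • x)) 0 c

/-- `A_I(u) = (I_{a+}^{1-α,g}[τ ↦ f(τ + Is)])(u)`, where `I = vecEmb e x`. -/
def AIfun (a al s : ℝ) (g g' : ℝ → ℝ) (f : Pt n → Cl) (x : Fin n → ℝ) : ℝ → Cl :=
  fracInt a (1 - al) g g' fun τ => f (τ, s • x)

/-- `B_I(v) = (I_{0+}^{1-β,h}[τ ↦ f(r + Iτ)])(v)`, where `I = vecEmb e x`. -/
def BIfun (be r : ℝ) (h h' : ℝ → ℝ) (f : Pt n → Cl) (x : Fin n → ℝ) : ℝ → Cl :=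
  fracInt 0 (1 - be) h h' fun τ => f (r, τ • x)

/-- `B_I^{c-}(v) = (I_{c-}^{1-β,h}[τ ↦ f(r + Iτ)])(v)`, where `I = vecEmb e x`. -/
def BIcfun (c be r : ℝ) (h h' : ℝ → ℝ) (f : Pt n → Cl) (x : Fin n → ℝ) : ℝ → Cl :=
  fracIntR c (1 - be) h h' fun τ => f (r, τ • x)

/-- Condition (m1): the maps `A_I` and `B_I` are of class C¹ for every `I ∈ 𝕊`. -/
def M1 (a b c al be r s : ℝ) (g g' h h' : ℝ → ℝ) (f : Pt n → Cl) : Prop :=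
  ∀ x ∈ USphere n,
    ContDiffOn ℝ 1 (AIfun a al s g g' f x) (Icc a b) ∧
    ContDiffOn ℝ 1 (BIfun be r h h' f x) (Icc 0 c)

/-- Riemann–Liouville fractional slice monogenic functions of order `(α,β)`
with respect to `(g,h)` on `S_{a,b,c}`. -/
def RLSM (a b c al be r s : ℝ) (g g' h h' : ℝ → ℝ) (e : Fin n → Cl) (f : Pt n → Cl) : Prop :=
  AC1 a b c r s f ∧ M1 a b c al be r s g g' h h' f ∧
  ∀ x ∈ USphere n, ∀ u ∈ Icc a b, ∀ v ∈ Icc 0 c,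
    (g' u)⁻¹ • derivWithin (AIfun a al s g g' f x) (Icc a b) u +
      vecEmb e x * ((h' v)⁻¹ • derivWithin (BIfun be r h h' f x) (Icc 0 c) v) = 0


theorem vecEmb_mul_self {e : Fin n → Cl} (he : CliffordRel e) {x : Fin n → ℝ}
    (hx : x ∈ USphere n) : vecEmb e x * vecEmb e x = -1 := by
  have hexp : vecEmb e x * vecEmb e x = ∑ i, ∑ j, (x i * x j) • (e i * e j) := by
    simp only [vecEmb, Finset.sum_mul_sum, smul_mul_smul_comm]
  have hswap : vecEmb e x * vecEmb e x = ∑ i, ∑ j, (x i * x j) • (e j * e i) := by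
    rw [hexp, Finset.sum_comm]
    simp only [mul_comm]
  have hadd : vecEmb e x * vecEmb e x + vecEmb e x * vecEmb e x = (2 : ℝ) • (-1 : Cl) := by
    nth_rewrite 1 [hexp]
    rw [hswap]
    simp only [← Finset.sum_add_distrib, ← smul_add, he _ _, smul_ite, smul_zero,
      Finset.sum_ite_eq, Finset.mem_univ, if_true, ← Finset.sum_smul, ← pow_two]
    rw [show ∑ i, x i ^ 2 = 1 from hx, one_smul, two_smul]
    norm_num
  rw [← two_smul ℝ] at hadd
  exact smul_right_injective Cl (two_ne_zero' ℝ) hadd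

/-- A function on `[a,b]` with constant derivative is affine. -/
theorem eq_add_smul_of_derivWithin_eq {E : Type*} [NormedAddCommGroup E] [NormedSpace ℝ E]
    {φ : ℝ → E} {a b : ℝ} {k : E} (hab : a < b) (hφ : DifferentiableOn ℝ φ (Icc a b))
    (hk : ∀ u ∈ Icc a b, derivWithin φ (Icc a b) u = k) :
    ∀ u ∈ Icc a b, φ u = φ a + (u - a) • k := by
  have hd : ∀ u ∈ Icc a b,
      HasDerivWithinAt (fun t => φ t - (t - a) • k) 0 (Icc a b) u := fun u hu => by
    have h := (hφ u hu).hasDerivWithinAt.sub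
      ((((hasDerivAt_id u).sub_const a).smul_const k).hasDerivWithinAt (s := Icc a b))
    rwa [hk u hu, one_smul, sub_self] at h
  intro u hu
  have h := constant_of_derivWithin_zero (fun t ht => (hd t ht).differentiableWithinAt)
    (fun t ht => (hd t (Ico_subset_Icc_self ht)).derivWithin
      (uniqueDiffOn_Icc hab t (Ico_subset_Icc_self ht))) u hu
  rw [sub_self, zero_smul, sub_zero] at h
  exact sub_eq_iff_eq_add.mp h

theorem fracInt_base (aa σ : ℝ) (g g' : ℝ → ℝ) (φ : ℝ → Cl) : fracInt aa σ g g' φ aa = 0 := by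
  simp [fracInt]

/-- A nonzero element of `ℂ_J`, where `J ^ 2 = -1`, is not a left zero divisor. -/
theorem eq_zero_of_smul_add_smul_mul_eq_zero {J k : Cl} (hJ : J * J = -1) {p q : ℝ} (hp : p ≠ 0)
    (h : p • k + q • (J * k) = 0) : k = 0 := by
  have hJk : J * (J * k) = -k := by rw [← mul_assoc, hJ, neg_one_mul]
  have h2 : (p ^ 2 + q ^ 2) • k = 0 := by
    have h3 : p • (p • k + q • (J * k)) - q • (J * (p • k + q • (J * k))) = 0 := by simp [h]
    rw [mul_add, mul_smul_comm, mul_smul_comm, hJk] at h3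
    rw [← h3]
    module
  exact (smul_eq_zero.mp h2).resolve_left (by positivity)

/-- Identity principle, fractional case with affine `g`, `h`. -/
theorem statement15 [CompleteSpace Cl] (e : Fin n → Cl) (he : CliffordRel e)
    (a b c r s al be δ₁ δ₂ ρ₁ ρ₂ : ℝ)
    (hab : a < b) (hc : 0 < c) (hr : r ∈ Icc a b) (hs : s ∈ Icc 0 c)
    (hal : al ∈ Ioo (0:ℝ) 1) (hbe : be ∈ Ioo (0:ℝ) 1)
    (hδ : 0 < δ₁) (hρ : 0 < ρ₁)
    (f : Pt n → Cl)
    (hf : RLSM a b c al be r s (fun u => δ₁ * u + δ₂) (fun _ => δ₁)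
      (fun v => ρ₁ * v + ρ₂) (fun _ => ρ₁) e f)
    (x : Fin n → ℝ) (hx : x ∈ USphere n)
    (hacc : ∃ p ∈ (Ioo a b ×ˢ Ioo 0 c : Set (ℝ × ℝ)), AccPt p (Filter.principal
      {q ∈ (Icc a b ×ˢ Icc 0 c : Set (ℝ × ℝ)) |
        ρ₁ • AIfun a al s (fun u => δ₁ * u + δ₂) (fun _ => δ₁) f x q.1
          + δ₁ • BIfun be r (fun v => ρ₁ * v + ρ₂) (fun _ => ρ₁) f x q.2 = 0})) :
    ∀ q ∈ (Icc a b ×ˢ Icc 0 c : Set (ℝ × ℝ)),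
      ρ₁ • AIfun a al s (fun u => δ₁ * u + δ₂) (fun _ => δ₁) f x q.1
        + δ₁ • BIfun be r (fun v => ρ₁ * v + ρ₂) (fun _ => ρ₁) f x q.2 = 0 := by
  obtain ⟨-, hm, hcr⟩ := hf
  obtain ⟨hA, hB⟩ := hm x hx
  replace hcr := hcr x hx
  have hA0 : AIfun a al s (fun u => δ₁ * u + δ₂) (fun _ => δ₁) f x a = 0 := fracInt_base ..
  have hB0 : BIfun be r (fun v => ρ₁ * v + ρ₂) (fun _ => ρ₁) f x 0 = 0 := fracInt_base ..
  set A := AIfun a al s (fun u => δ₁ * u + δ₂) (fun _ => δ₁) f x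
  set B := BIfun be r (fun v => ρ₁ * v + ρ₂) (fun _ => ρ₁) f x
  have hJ := vecEmb_mul_self he hx
  set J := vecEmb e x
  obtain ⟨k, hk⟩ : ∃ k, k = derivWithin A (Icc a b) a := ⟨_, rfl⟩
  have hA' : ∀ u ∈ Icc a b, derivWithin A (Icc a b) u = k := fun u hu => by
    have h := (hcr u hu 0 (left_mem_Icc.2 hc.le)).trans
      (hcr a (left_mem_Icc.2 hab.le) 0 (left_mem_Icc.2 hc.le)).symm
    rw [hk]
    exact smul_right_injective Cl (inv_ne_zero hδ.ne') (add_right_cancel h)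
  have hB' : ∀ v ∈ Icc 0 c, derivWithin B (Icc 0 c) v = (ρ₁ * δ₁⁻¹) • (J * k) := fun v hv => by
    have h := congrArg (J * ·) (hcr a (left_mem_Icc.2 hab.le) v hv)
    simp only [mul_add, ← mul_assoc, hJ, mul_zero, neg_one_mul, mul_smul_comm, smul_neg, ← hk] at h
    rw [mul_smul, add_neg_eq_zero.mp h, smul_inv_smul₀ hρ.ne']
  have hF : ∀ q ∈ (Icc a b ×ˢ Icc 0 c : Set (ℝ × ℝ)),
      ρ₁ • A q.1 + δ₁ • B q.2 = (ρ₁ * (q.1 - a)) • k + (ρ₁ * q.2) • (J * k) := fun q hq => by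
    rw [eq_add_smul_of_derivWithin_eq hab (hA.differentiableOn one_ne_zero) hA' _ hq.1,
      eq_add_smul_of_derivWithin_eq hc (hB.differentiableOn one_ne_zero) hB' _ hq.2, hA0, hB0,
      zero_add, zero_add, sub_zero, smul_smul, smul_smul, smul_smul]
    congr 2
    field_simp
  obtain ⟨p, hp, hacc⟩ := hacc
  obtain ⟨q, ⟨hq, hqmem, hq0⟩, -⟩ := accPt_iff_nhds.mp hacc _
    ((isOpen_Ioo.prod isOpen_Ioo).mem_nhds hp)
  have hk0 : k = 0 := eq_zero_of_smul_add_smul_mul_eq_zero hJ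
    (mul_pos hρ (sub_pos.2 hq.1.1)).ne' ((hF q hqmem).symm.trans hq0)
  intro q hq
  rw [hF q hq, hk0, mul_zero, smul_zero, smul_zero, add_zero]
end
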